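/- Let d ≥ 1, let h and ζ be smooth ℤ^d-periodic functions on ℝ^d, let Ω = {(x,y) ∈ ℝ^d × ℝ : y < h(x)}, and let φ : closure(Ω) → ℝ be smooth, ℤ^d-periodic in x, harmonic in Ω (Δ_{x,y} φ = 0), with boundary value φ(x,h(x)) = ζ(x) for all x, such that ∇_{x,y}φ is square-integrable on the fundamental domain of Ω and converges to 0 uniformly in x as y → −∞. Define the traces B(x) = ∂_y φ(x,h(x)) and (G(h)ζ)(x) = B(x) − ∇h(x)·( ∇ζ(x) − B(x)∇h(x) ). Then ∫_{𝕋^d} (G(h)ζ)^2 dx ≤ ∫_{𝕋^d} (1+|∇h|^2) |∇ζ − B ∇h|^2 dx. -/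

import Mathlib

open MeasureTheory Real

/-- Horizontal partial derivative `∂ᵢ f` of a function on `ℝᵈ`. -/
noncomputable def pder {d : ℕ} (i : Fin d) (f : EuclideanSpace ℝ (Fin d) → ℝ)
    (x : EuclideanSpace ℝ (Fin d)) : ℝ :=
  fderiv ℝ f x (EuclideanSpace.single i 1)

/-- Horizontal partial derivative `∂_{xᵢ} f` of a function on `ℝᵈ × ℝ`. -/
noncomputable def pdx {d : ℕ} (i : Fin d) (f : EuclideanSpace ℝ (Fin d) × ℝ → ℝ)
    (p : EuclideanSpace ℝ (Fin d) × ℝ) : ℝ :=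
  fderiv ℝ f p (EuclideanSpace.single i 1, 0)

/-- Vertical partial derivative `∂_y f` of a function on `ℝᵈ × ℝ`. -/
noncomputable def pdy {d : ℕ} (f : EuclideanSpace ℝ (Fin d) × ℝ → ℝ)
    (p : EuclideanSpace ℝ (Fin d) × ℝ) : ℝ :=
  fderiv ℝ f p (0, 1)

/-- The fundamental domain `[0,1)^d` of the torus `𝕋^d`. -/
def fundDom (d : ℕ) : Set (EuclideanSpace ℝ (Fin d)) :=
  {x | ∀ i, 0 ≤ x i ∧ x i < 1}

/-- `ℤ^d`-periodicity of a function on `ℝ^d`. -/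
def ZPeriodic {d : ℕ} (f : EuclideanSpace ℝ (Fin d) → ℝ) : Prop :=
  ∀ (x : EuclideanSpace ℝ (Fin d)) (k : Fin d → ℤ),
    f (x + (WithLp.equiv 2 (Fin d → ℝ)).symm (fun i => (k i : ℝ))) = f x

/-- `ℤ^d`-periodicity in the horizontal variable of a function on `ℝᵈ × ℝ`. -/
def ZPeriodicX {d : ℕ} (f : EuclideanSpace ℝ (Fin d) × ℝ → ℝ) : Prop :=
  ∀ (x : EuclideanSpace ℝ (Fin d)) (y : ℝ) (k : Fin d → ℤ),
    f (x + (WithLp.equiv 2 (Fin d → ℝ)).symm (fun i => (k i : ℝ)), y) = f (x, y)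

/-- Squared norm of the full gradient `|∇_{x,y} f|²` on `ℝᵈ × ℝ`. -/
noncomputable def fullGradSq {d : ℕ} (f : EuclideanSpace ℝ (Fin d) × ℝ → ℝ)
    (p : EuclideanSpace ℝ (Fin d) × ℝ) : ℝ :=
  (∑ i, (pdx i f p) ^ 2) + (pdy f p) ^ 2

lemma fundDom_isBounded (d : ℕ) : Bornology.IsBounded (fundDom d) := by
  have : fundDom d ⊆ (WithLp.ofLp : EuclideanSpace ℝ (Fin d) → (Fin d → ℝ)) ⁻¹' (Set.Icc 0 1) := by
    intro x hx
    exact ⟨fun i => (hx i).1, fun i => (hx i).2.le⟩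
  refine Bornology.IsBounded.subset ?_ this
  exact (PiLp.antilipschitzWith_ofLp 2 (fun _ : Fin d => ℝ)).isBounded_preimage
    (Metric.isBounded_Icc _ _)

lemma fundDom_compact (d : ℕ) : IsCompact (closure (fundDom d)) :=
  (fundDom_isBounded d).isCompact_closure

lemma fundDom_preimage (d : ℕ) : (WithLp.toLp 2 : (Fin d → ℝ) → EuclideanSpace ℝ (Fin d)) ⁻¹'
    (fundDom d) = Set.pi Set.univ fun i => Set.Ico ((0 : Fin d → ℝ) i) ((1 : Fin d → ℝ) i) := by
  ext x
  simp [fundDom, Set.mem_pi]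

lemma fundDom_meas (d : ℕ) : MeasurableSet (fundDom d) := by
  have : fundDom d = ⋂ i, {x : EuclideanSpace ℝ (Fin d) | 0 ≤ x i ∧ x i < 1} := by
    ext x; simp [fundDom]
  rw [this]
  refine MeasurableSet.iInter fun i => ?_
  have hm : Measurable fun x : EuclideanSpace ℝ (Fin d) => x i := by fun_prop
  exact (measurableSet_le measurable_const hm).inter (measurableSet_lt hm measurable_const)

lemma intOn_fundDom {d : ℕ} {f : EuclideanSpace ℝ (Fin d) → ℝ} (hf : Continuous f) :
    IntegrableOn f (fundDom d) :=
  (hf.continuousOn.integrableOn_compact (fundDom_compact d)).mono_set subset_closure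

lemma integral_fundDom (d : ℕ) (f : EuclideanSpace ℝ (Fin d) → ℝ) :
    ∫ x in fundDom d, f x = ∫ x in Set.Icc (0 : Fin d → ℝ) 1, f (WithLp.toLp 2 x) := by
  rw [← (PiLp.volume_preserving_toLp (Fin d)).setIntegral_preimage_emb
    (MeasurableEquiv.toLp 2 (Fin d → ℝ)).measurableEmbedding, fundDom_preimage]
  exact setIntegral_congr_set Measure.univ_pi_Ico_ae_eq_Icc

lemma integral_div_zero {n : ℕ} (g : Fin (n+1) → EuclideanSpace ℝ (Fin (n+1)) → ℝ)
    (hg : ∀ i, ContDiff ℝ 1 (g i)) (hp : ∀ i, ZPeriodic (g i)) :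
    ∫ x in fundDom (n+1), ∑ i, pder i (g i) x = 0 := by
  rw [integral_fundDom]
  let L : (Fin (n+1) → ℝ) →L[ℝ] EuclideanSpace ℝ (Fin (n+1)) :=
    ((EuclideanSpace.equiv (Fin (n+1)) ℝ).symm : (Fin (n+1) → ℝ) →L[ℝ] _)
  have hL : ∀ x, L x = WithLp.toLp 2 x := fun x => rfl
  have key := integral_divergence_of_hasFDerivAt_off_countable' (0 : Fin (n+1) → ℝ) 1
    (fun i => zero_le_one) (fun i x => g i (L x)) (fun i x => (fderiv ℝ (g i) (L x)).comp L) ∅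
    Set.countable_empty (fun i => ((hg i).continuous.comp L.continuous).continuousOn)
    (fun x _ i => (((hg i).differentiable one_ne_zero (L x)).hasFDerivAt).comp x L.hasFDerivAt)
    (by
      refine Continuous.integrableOn_Icc ?_
      refine continuous_finsetSum _ fun i _ => ?_
      have := ((hg i).continuous_fderiv one_ne_zero).comp L.continuous
      exact this.clm_apply continuous_const)
  have e1 : (fun x : Fin (n+1) → ℝ => ∑ i, pder i (g i) (WithLp.toLp 2 x)) =
      fun x => ∑ i, ((fderiv ℝ (g i) (L x)).comp L) (Pi.single i 1) := by
    ext x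
    refine Finset.sum_congr rfl fun i _ => ?_
    simp only [pder, ContinuousLinearMap.comp_apply, hL]
    rfl
  rw [e1, key]
  refine Finset.sum_eq_zero fun i _ => ?_
  rw [sub_eq_zero]
  refine setIntegral_congr_fun measurableSet_Icc fun x _ => ?_
  have := hp i (L (i.insertNth 0 x)) (Pi.single i 1)
  simp only [Pi.zero_apply, Pi.one_apply]
  rw [← this]
  congr 1
  ext j
  refine Fin.succAboveCases i ?_ (fun k => ?_) j
  · simp [hL]
  · simp [hL]

lemma pdx_contDiff {d : ℕ} (i : Fin d) {φ : EuclideanSpace ℝ (Fin d) × ℝ → ℝ}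
    (hφ : ContDiff ℝ (⊤ : ℕ∞) φ) : ContDiff ℝ (⊤ : ℕ∞) (pdx i φ) := by
  have : ContDiff ℝ (⊤ : ℕ∞) (fderiv ℝ φ) := hφ.fderiv_right (by simp)
  exact this.clm_apply contDiff_const

lemma pdy_contDiff {d : ℕ} {φ : EuclideanSpace ℝ (Fin d) × ℝ → ℝ}
    (hφ : ContDiff ℝ (⊤ : ℕ∞) φ) : ContDiff ℝ (⊤ : ℕ∞) (pdy φ) := by
  have : ContDiff ℝ (⊤ : ℕ∞) (fderiv ℝ φ) := hφ.fderiv_right (by simp)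
  exact this.clm_apply contDiff_const

lemma pder_contDiff {d : ℕ} (i : Fin d) {φ : EuclideanSpace ℝ (Fin d) → ℝ}
    (hφ : ContDiff ℝ (⊤ : ℕ∞) φ) : ContDiff ℝ (⊤ : ℕ∞) (pder i φ) := by
  have : ContDiff ℝ (⊤ : ℕ∞) (fderiv ℝ φ) := hφ.fderiv_right (by simp)
  exact this.clm_apply contDiff_const

lemma fderiv_per {d : ℕ} {φ : EuclideanSpace ℝ (Fin d) × ℝ → ℝ} (hp : ZPeriodicX φ)
    (x : EuclideanSpace ℝ (Fin d)) (y : ℝ) (k : Fin d → ℤ) :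
    fderiv ℝ φ (x + (WithLp.equiv 2 (Fin d → ℝ)).symm (fun i => (k i : ℝ)), y)
      = fderiv ℝ φ (x, y) := by
  set v := (WithLp.equiv 2 (Fin d → ℝ)).symm (fun i => (k i : ℝ)) with hv
  have h1 : (fun p => φ (p + (v, 0))) = φ := by
    ext ⟨a, b⟩
    have := hp a b k
    simpa [hv] using this
  have h2 := fderiv_comp_add_right (𝕜 := ℝ) (f := φ) (x := (x, y)) (v, 0)
  rw [h1] at h2
  rw [h2]; simp

lemma pdx_pdy_comm {d : ℕ} (i : Fin d) {φ : EuclideanSpace ℝ (Fin d) × ℝ → ℝ}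
    (hφ : ContDiff ℝ (⊤ : ℕ∞) φ) (p) : pdx i (pdy φ) p = pdy (pdx i φ) p := by
  have hd : DifferentiableAt ℝ (fderiv ℝ φ) p := by
    have : ContDiff ℝ (⊤ : ℕ∞) (fderiv ℝ φ) := hφ.fderiv_right (by simp)
    exact this.differentiable (by simp) p
  have hs : IsSymmSndFDerivAt ℝ φ p := by
    refine hφ.contDiffAt.isSymmSndFDerivAt ?_
    simp
    exact WithTop.coe_le_coe.2 le_top
  have e (v w) : fderiv ℝ (fun q => fderiv ℝ φ q v) p w = fderiv ℝ (fderiv ℝ φ) p w v := by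
    rw [fderiv_clm_apply hd (differentiableAt_const _)]
    simp
  unfold pdx pdy
  rw [e, e]
  exact hs _ _

lemma pder_comp {d : ℕ} (i : Fin d) {f : EuclideanSpace ℝ (Fin d) × ℝ → ℝ}
    (hf : Differentiable ℝ f) {h : EuclideanSpace ℝ (Fin d) → ℝ} (hh : Differentiable ℝ h)
    (s : ℝ) (x) :
    pder i (fun x => f (x, h x + s)) x =
      pdx i f (x, h x + s) + pdy f (x, h x + s) * pder i h x := by
  have h1 : HasFDerivAt (fun x => (x, h x + s))
      ((ContinuousLinearMap.id ℝ _).prod (fderiv ℝ h x)) x :=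
    (hasFDerivAt_id x).prodMk ((hh x).hasFDerivAt.add_const s)
  have h2 := ((hf (x, h x + s)).hasFDerivAt).comp x h1
  have h3 : fderiv ℝ (fun x => f (x, h x + s)) x = _ := h2.fderiv
  unfold pder pdx pdy
  rw [h3]
  simp only [ContinuousLinearMap.comp_apply, ContinuousLinearMap.prod_apply,
    ContinuousLinearMap.id_apply]
  set a := fderiv ℝ h x (EuclideanSpace.single i 1)
  have : ((EuclideanSpace.single i (1:ℝ) : EuclideanSpace ℝ (Fin d)), a) =
    (EuclideanSpace.single i (1:ℝ), (0:ℝ)) + a • ((0 : EuclideanSpace ℝ (Fin d)), (1:ℝ)) := by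
    simp
  rw [this, map_add, map_smul, smul_eq_mul, mul_comm]

lemma deriv_comp_y {d : ℕ} {f : EuclideanSpace ℝ (Fin d) × ℝ → ℝ}
    (hf : Differentiable ℝ f) (x : EuclideanSpace ℝ (Fin d)) (c s : ℝ) :
    HasDerivAt (fun s => f (x, c + s)) (pdy f (x, c + s)) s := by
  have h1 : HasDerivAt (fun s : ℝ => (x, c + s)) ((0 : EuclideanSpace ℝ (Fin d)), (1:ℝ)) s :=
    (hasDerivAt_const s x).prodMk ((hasDerivAt_id s).const_add c)
  exact ((hf (x, c + s)).hasFDerivAt).comp_hasDerivAt s h1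

/-- The Rellich integrand on the shifted graph. -/
noncomputable def rF {d : ℕ} (h : EuclideanSpace ℝ (Fin d) → ℝ)
    (φ : EuclideanSpace ℝ (Fin d) × ℝ → ℝ) (s : ℝ) (x : EuclideanSpace ℝ (Fin d)) : ℝ :=
  (∑ i, pdx i φ (x, h x + s) ^ 2) - pdy φ (x, h x + s) ^ 2
    + ∑ i, pder i h x * (2 * pdy φ (x, h x + s) * pdx i φ (x, h x + s))

/-- Its derivative in the shift. -/
noncomputable def rF' {d : ℕ} (h : EuclideanSpace ℝ (Fin d) → ℝ)
    (φ : EuclideanSpace ℝ (Fin d) × ℝ → ℝ) (s : ℝ) (x : EuclideanSpace ℝ (Fin d)) : ℝ :=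
  (∑ i, 2 * pdx i φ (x, h x + s) * pdy (pdx i φ) (x, h x + s))
    - 2 * pdy φ (x, h x + s) * pdy (pdy φ) (x, h x + s)
    + ∑ i, pder i h x * (2 * pdy (pdy φ) (x, h x + s) * pdx i φ (x, h x + s)
      + 2 * pdy φ (x, h x + s) * pdy (pdx i φ) (x, h x + s))

section
variable {d : ℕ} {h : EuclideanSpace ℝ (Fin d) → ℝ}
    (hsm : ContDiff ℝ (⊤ : ℕ∞) h) {φ : EuclideanSpace ℝ (Fin d) × ℝ → ℝ}
    (hφsm : ContDiff ℝ (⊤ : ℕ∞) φ)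

lemma graph_cont {h : EuclideanSpace ℝ (Fin d) → ℝ} (hsm : ContDiff ℝ (⊤ : ℕ∞) h)
    {f : EuclideanSpace ℝ (Fin d) × ℝ → ℝ} (hf : Continuous f) :
    Continuous (fun q : ℝ × EuclideanSpace ℝ (Fin d) => f (q.2, h q.2 + q.1)) := by
  have := hsm.continuous
  fun_prop

lemma rF_cont (hsm : ContDiff ℝ (⊤ : ℕ∞) h) (hφsm : ContDiff ℝ (⊤ : ℕ∞) φ) :
    Continuous (fun q : ℝ × EuclideanSpace ℝ (Fin d) => rF h φ q.1 q.2) := by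
  have a := graph_cont hsm (pdy_contDiff hφsm).continuous
  have b := fun i => graph_cont hsm (pdx_contDiff i hφsm).continuous
  have c := fun i => (pder_contDiff i hsm).continuous
  unfold rF
  fun_prop

lemma rF_cont_x (hsm : ContDiff ℝ (⊤ : ℕ∞) h) (hφsm : ContDiff ℝ (⊤ : ℕ∞) φ) (s : ℝ) :
    Continuous (fun x => rF h φ s x) := by
  have := (rF_cont hsm hφsm).comp (Continuous.prodMk_right s)
  simpa only [Function.comp_def] using this

lemma rF'_cont (hsm : ContDiff ℝ (⊤ : ℕ∞) h) (hφsm : ContDiff ℝ (⊤ : ℕ∞) φ) :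
    Continuous (fun q : ℝ × EuclideanSpace ℝ (Fin d) => rF' h φ q.1 q.2) := by
  have a := graph_cont hsm (pdy_contDiff hφsm).continuous
  have a' := graph_cont hsm (pdy_contDiff (pdy_contDiff hφsm)).continuous
  have b := fun i => graph_cont hsm (pdx_contDiff i hφsm).continuous
  have b' := fun i => graph_cont hsm (pdy_contDiff (pdx_contDiff i hφsm)).continuous
  have c := fun i => (pder_contDiff i hsm).continuous
  unfold rF'
  fun_prop

lemma rF_deriv (hφsm : ContDiff ℝ (⊤ : ℕ∞) φ) (s : ℝ) (x) :
    HasDerivAt (fun s => rF h φ s x) (rF' h φ s x) s := by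
  have a := deriv_comp_y ((pdy_contDiff hφsm).differentiable (by simp)) x (h x) s
  have b := fun i => deriv_comp_y ((pdx_contDiff i hφsm).differentiable (by simp)) x (h x) s
  unfold rF rF'
  refine ((HasDerivAt.fun_sum fun i _ => ?_).sub ?_).add (HasDerivAt.fun_sum fun i _ => ?_)
  · simpa using (b i).fun_pow 2
  · simpa using a.fun_pow 2
  · exact ((a.const_mul 2).mul (b i)).const_mul _

lemma rI_deriv (hsm : ContDiff ℝ (⊤ : ℕ∞) h) (hφsm : ContDiff ℝ (⊤ : ℕ∞) φ) (s : ℝ) :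
    HasDerivAt (fun s => ∫ x in fundDom d, rF h φ s x) (∫ x in fundDom d, rF' h φ s x) s := by
  obtain ⟨C, hC⟩ := ((isCompact_closedBall s 1).prod (fundDom_compact d)).exists_bound_of_continuousOn
    (rF'_cont hsm hφsm).continuousOn
  have c1 := fun s => (rF_cont hsm hφsm).comp (Continuous.prodMk_right s)
  have c2 := fun s => (rF'_cont hsm hφsm).comp (Continuous.prodMk_right s)
  refine (hasDerivAt_integral_of_dominated_loc_of_deriv_le (bound := fun _ => C)
    (Metric.closedBall_mem_nhds s one_pos)
    (Filter.Eventually.of_forall fun s => (c1 s).aestronglyMeasurable) (intOn_fundDom (c1 s))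
    (c2 s).aestronglyMeasurable ?_ (intOn_fundDom continuous_const) ?_).2
  · refine (ae_restrict_iff' (fundDom_meas d)).2 (Filter.Eventually.of_forall fun x hx t ht => ?_)
    exact hC (t, x) ⟨ht, subset_closure hx⟩
  · exact Filter.Eventually.of_forall fun x t _ => rF_deriv hφsm t x
end

lemma rI'_zero {d : ℕ} (hd : 1 ≤ d) {h : EuclideanSpace ℝ (Fin d) → ℝ}
    (hsm : ContDiff ℝ (⊤ : ℕ∞) h) (hper : ZPeriodic h)
    {φ : EuclideanSpace ℝ (Fin d) × ℝ → ℝ}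
    (hφsm : ContDiff ℝ (⊤ : ℕ∞) φ) (hφper : ZPeriodicX φ)
    (hφharm : ∀ p : EuclideanSpace ℝ (Fin d) × ℝ, p.2 < h p.1 →
      (∑ i, pdx i (pdx i φ) p) + pdy (pdy φ) p = 0) {s : ℝ} (hs : s < 0) :
    ∫ x in fundDom d, rF' h φ s x = 0 := by
  obtain ⟨n, rfl⟩ : ∃ n, d = n + 1 := ⟨d - 1, by omega⟩
  let g : Fin (n+1) → EuclideanSpace ℝ (Fin (n+1)) → ℝ := fun i x =>
    2 * pdy φ (x, h x + s) * pdx i φ (x, h x + s)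
  have hgr : ContDiff ℝ 1 (fun x => (x, h x + s)) :=
    contDiff_id.prodMk ((hsm.of_le (by exact_mod_cast le_top)).add contDiff_const)
  have ha : ContDiff ℝ 1 (pdy φ) := (pdy_contDiff hφsm).of_le (by exact_mod_cast le_top)
  have hb := fun i => (pdx_contDiff i hφsm).of_le (n := ((⊤ : ℕ∞) : WithTop ℕ∞)) (m := 1) (by exact_mod_cast le_top)
  have hga : ContDiff ℝ 1 (fun x => pdy φ (x, h x + s)) := ha.comp hgr
  have hgb : ∀ i, ContDiff ℝ 1 (fun x => pdx i φ (x, h x + s)) := fun i => (hb i).comp hgr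
  have key := integral_div_zero g (fun i => (contDiff_const.mul hga).mul (hgb i))
    (fun i x k => by
      simp only [g, pdy, pdx]
      rw [hper x k, fderiv_per hφper])
  rw [← key]
  congr 1
  ext x
  have hg' : ∀ i, pder i (g i) x =
      2 * (pdy (pdx i φ) (x, h x + s) + pdy (pdy φ) (x, h x + s) * pder i h x)
        * pdx i φ (x, h x + s)
      + 2 * pdy φ (x, h x + s) *
        (pdx i (pdx i φ) (x, h x + s) + pdy (pdx i φ) (x, h x + s) * pder i h x) := by
    intro i
    have hhd : Differentiable ℝ h := hsm.differentiable (by simp)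
    have p1 := pder_comp i (ha.differentiable one_ne_zero) hhd s x
    have p2 := pder_comp i ((hb i).differentiable one_ne_zero) hhd s x
    rw [pdx_pdy_comm i hφsm] at p1
    rw [← p1, ← p2]
    have d1 := ((hga.differentiable one_ne_zero x).hasFDerivAt).const_mul 2
    have d2 := ((hgb i).differentiable one_ne_zero x).hasFDerivAt
    have d3 : fderiv ℝ (g i) x = _ := (d1.mul d2).fderiv
    simp only [pder]
    rw [d3]
    simp
    ring
  have hh := hφharm (x, h x + s) (by simp [hs])
  have hyy : pdy (pdy φ) (x, h x + s) = - ∑ i, pdx i (pdx i φ) (x, h x + s) := by linarith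
  simp only [hg', rF']
  have : 2 * pdy φ (x, h x + s) * pdy (pdy φ) (x, h x + s) =
      - ∑ i, 2 * pdy φ (x, h x + s) * pdx i (pdx i φ) (x, h x + s) := by
    rw [hyy, ← Finset.mul_sum]; ring
  rw [this, sub_neg_eq_add, ← Finset.sum_add_distrib, ← Finset.sum_add_distrib]
  exact Finset.sum_congr rfl fun i _ => by ring

lemma rF_bound {d : ℕ} (h : EuclideanSpace ℝ (Fin d) → ℝ)
    (φ : EuclideanSpace ℝ (Fin d) × ℝ → ℝ) (s : ℝ) (x) {ε : ℝ}
    (he : fullGradSq φ (x, h x + s) ≤ ε) :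
    |rF h φ s x| ≤ ε * (1 + ∑ i, |pder i h x|) := by
  unfold fullGradSq at he
  unfold rF
  set B := pdy φ (x, h x + s)
  have hS : 0 ≤ ∑ i, pdx i φ (x, h x + s) ^ 2 := Finset.sum_nonneg fun i _ => sq_nonneg _
  have h1 : |(∑ i, pdx i φ (x, h x + s) ^ 2) - B ^ 2| ≤ ε := by
    rw [abs_le]; constructor <;> nlinarith [sq_nonneg B]
  have h2 : |∑ i, pder i h x * (2 * B * pdx i φ (x, h x + s))| ≤ ε * ∑ i, |pder i h x| := by
    rw [Finset.mul_sum]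
    refine (Finset.abs_sum_le_sum_abs _ _).trans (Finset.sum_le_sum fun i _ => ?_)
    rw [abs_mul, mul_comm]
    refine mul_le_mul_of_nonneg_right ?_ (abs_nonneg _)
    have : pdx i φ (x, h x + s) ^ 2 ≤ ∑ i, pdx i φ (x, h x + s) ^ 2 :=
      Finset.single_le_sum (f := fun i => pdx i φ (x, h x + s) ^ 2)
        (fun i _ => sq_nonneg _) (Finset.mem_univ i)
    rw [abs_le]
    constructor <;> nlinarith [sq_nonneg (B + pdx i φ (x, h x + s)), sq_nonneg (B - pdx i φ (x, h x + s))]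
  calc _ ≤ _ := abs_add_le _ _
    _ ≤ ε + ε * ∑ i, |pder i h x| := add_le_add h1 h2
    _ = _ := by ring

lemma rI_zero {d : ℕ} (hd : 1 ≤ d) {h : EuclideanSpace ℝ (Fin d) → ℝ}
    (hsm : ContDiff ℝ (⊤ : ℕ∞) h) (hper : ZPeriodic h)
    {φ : EuclideanSpace ℝ (Fin d) × ℝ → ℝ}
    (hφsm : ContDiff ℝ (⊤ : ℕ∞) φ) (hφper : ZPeriodicX φ)
    (hφharm : ∀ p : EuclideanSpace ℝ (Fin d) × ℝ, p.2 < h p.1 →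
      (∑ i, pdx i (pdx i φ) p) + pdy (pdy φ) p = 0)
    (hφdecay : ∀ ε > 0, ∃ Y : ℝ,
      ∀ (x : EuclideanSpace ℝ (Fin d)) (y : ℝ), y ≤ Y →
        fullGradSq φ (x, y) ≤ ε) :
    ∫ x in fundDom d, rF h φ 0 x = 0 := by
  have hconst : ∀ s ≤ 0, ∫ x in fundDom d, rF h φ 0 x = ∫ x in fundDom d, rF h φ s x := by
    intro s hs
    refine constant_of_has_deriv_right_zero (f := fun s => ∫ x in fundDom d, rF h φ s x)
      (a := s) (b := 0) (fun t _ => (rI_deriv hsm hφsm t).continuousAt.continuousWithinAt)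
      (fun t ht => ?_) 0 ⟨hs, le_rfl⟩
    have := rI_deriv hsm hφsm t
    rw [rI'_zero hd hsm hper hφsm hφper hφharm ht.2] at this
    exact this.hasDerivWithinAt
  obtain ⟨M, hM⟩ := (fundDom_compact d).exists_bound_of_continuousOn hsm.continuous.continuousOn
  have hc : Continuous fun x => 1 + ∑ i, |pder i h x| := by
    have c := fun i => (pder_contDiff i hsm).continuous
    fun_prop
  set K := ∫ x in fundDom d, (1 + ∑ i, |pder i h x|) with hK
  have hb : ∀ ε > 0, |∫ x in fundDom d, rF h φ 0 x| ≤ ε * K := by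
    intro ε he
    obtain ⟨Y, hY⟩ := hφdecay ε he
    rw [hconst (min 0 (Y - M)) (min_le_left _ _), hK, ← integral_const_mul, ← Real.norm_eq_abs]
    refine norm_integral_le_of_norm_le ((intOn_fundDom hc).const_mul ε) ?_
    refine (ae_restrict_iff' (fundDom_meas d)).2 (Filter.Eventually.of_forall fun x hx => ?_)
    refine rF_bound h φ _ x (hY x _ ?_)
    have := (le_abs_self _).trans (hM x (subset_closure hx))
    have := min_le_right 0 (Y - M)
    linarith
  have hK0 : 0 ≤ K := integral_nonneg fun x => by positivity
  by_contra hne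
  have hp := abs_pos.2 hne
  have := hb (|∫ x in fundDom d, rF h φ 0 x| / (2 * (K + 1))) (by positivity)
  rw [div_mul_eq_mul_div, le_div_iff₀ (by positivity)] at this
  nlinarith

lemma rF_pointwise {d : ℕ} (h : EuclideanSpace ℝ (Fin d) → ℝ)
    (φ : EuclideanSpace ℝ (Fin d) × ℝ → ℝ) (x) :
    (pdy φ (x, h x) - ∑ i, pder i h x * pdx i φ (x, h x)) ^ 2 + rF h φ 0 x ≤
      (1 + ∑ i, (pder i h x) ^ 2) * ∑ i, pdx i φ (x, h x) ^ 2 := by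
  have cs := Finset.sum_mul_sq_le_sq_mul_sq Finset.univ (fun i => pder i h x)
    (fun i => pdx i φ (x, h x))
  have e : ∑ i, pder i h x * (2 * pdy φ (x, h x) * pdx i φ (x, h x)) =
      2 * pdy φ (x, h x) * ∑ i, pder i h x * pdx i φ (x, h x) := by
    rw [Finset.mul_sum]
    exact Finset.sum_congr rfl fun i _ => by ring
  simp only [rF, add_zero]
  rw [e]
  linarith

lemma rellich_core {d : ℕ} {h : EuclideanSpace ℝ (Fin d) → ℝ}
    (hsm : ContDiff ℝ (⊤ : ℕ∞) h) {φ : EuclideanSpace ℝ (Fin d) × ℝ → ℝ}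
    (hφsm : ContDiff ℝ (⊤ : ℕ∞) φ) (hz : ∫ x in fundDom d, rF h φ 0 x = 0) :
    ∫ x in fundDom d, (pdy φ (x, h x) - ∑ i, pder i h x * pdx i φ (x, h x)) ^ 2 ≤
      ∫ x in fundDom d, (1 + ∑ i, (pder i h x) ^ 2) * ∑ i, pdx i φ (x, h x) ^ 2 := by
  have cg : Continuous fun x => (x, h x) := continuous_id.prodMk hsm.continuous
  have a : Continuous fun x => pdy φ (x, h x) := (pdy_contDiff hφsm).continuous.comp cg
  have b : ∀ i, Continuous fun x => pdx i φ (x, h x) :=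
    fun i => (pdx_contDiff i hφsm).continuous.comp cg
  have c := fun i => (pder_contDiff i hsm).continuous
  have c0 : Continuous (fun x => rF h φ 0 x) :=
    rF_cont_x hsm hφsm 0
  have i0 : Integrable (fun x => rF h φ 0 x) (volume.restrict (fundDom d)) :=
    intOn_fundDom c0
  have i1 : Integrable (fun x => (pdy φ (x, h x) - ∑ i, pder i h x * pdx i φ (x, h x)) ^ 2)
      (volume.restrict (fundDom d)) := intOn_fundDom (by fun_prop)
  have i2 : Integrable (fun x => (1 + ∑ i, (pder i h x) ^ 2) * ∑ i, pdx i φ (x, h x) ^ 2)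
      (volume.restrict (fundDom d)) := intOn_fundDom (by fun_prop)
  have hle : ∫ x in fundDom d, ((pdy φ (x, h x) - ∑ i, pder i h x * pdx i φ (x, h x)) ^ 2
      + rF h φ 0 x) ≤ ∫ x in fundDom d, (1 + ∑ i, (pder i h x) ^ 2) * ∑ i, pdx i φ (x, h x) ^ 2 :=
    integral_mono (i1.add i0) i2 (fun x => rF_pointwise h φ x)
  rw [integral_add i1 i0, hz, add_zero] at hle
  exact hle

/-- **Rellich-type estimate** for the Dirichlet-to-Neumann operator (Lemma of
Appendix `A:Rellich`): with `B(x) = ∂_yφ(x,h(x))` and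
`G(h)ζ = B − ∇h·(∇ζ − B∇h)`, one has
`∫ (G(h)ζ)² ≤ ∫ (1+|∇h|²)|∇ζ − B∇h|²`. -/
theorem rellich_estimate (d : ℕ) (hd : 1 ≤ d)
    (h ζ : EuclideanSpace ℝ (Fin d) → ℝ)
    (hsm : ContDiff ℝ (⊤ : ℕ∞) h)
    (hper : ZPeriodic h)
    (hζsm : ContDiff ℝ (⊤ : ℕ∞) ζ)
    (hζper : ZPeriodic ζ)
    (φ : EuclideanSpace ℝ (Fin d) × ℝ → ℝ)
    (hφsm : ContDiff ℝ (⊤ : ℕ∞) φ)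
    (hφper : ZPeriodicX φ)
    (hφharm : ∀ p : EuclideanSpace ℝ (Fin d) × ℝ, p.2 < h p.1 →
      (∑ i, pdx i (pdx i φ) p) + pdy (pdy φ) p = 0)
    (hφbd : ∀ x, φ (x, h x) = ζ x)
    (hφint : IntegrableOn (fun p => fullGradSq φ p)
      {p : EuclideanSpace ℝ (Fin d) × ℝ | p.1 ∈ fundDom d ∧ p.2 < h p.1})
    (hφdecay : ∀ ε > 0, ∃ Y : ℝ,
      ∀ (x : EuclideanSpace ℝ (Fin d)) (y : ℝ), y ≤ Y →
        fullGradSq φ (x, y) ≤ ε) :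
    (∫ x in fundDom d,
        (pdy φ (x, h x)
          - ∑ i, pder i h x * (pder i ζ x - pdy φ (x, h x) * pder i h x)) ^ 2)
      ≤ ∫ x in fundDom d,
          (1 + ∑ i, (pder i h x) ^ 2) *
            (∑ i, (pder i ζ x - pdy φ (x, h x) * pder i h x) ^ 2) := by
  have hV : ∀ i x, pder i ζ x - pdy φ (x, h x) * pder i h x = pdx i φ (x, h x) := by
    intro i x
    have := pder_comp i (hφsm.differentiable (by simp)) (hsm.differentiable (by simp)) 0 x
    simp only [add_zero, hφbd] at this
    have e : pder i ζ x = pder i (fun x => ζ x) x := rfl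
    rw [e, this]; ring
  simp only [hV]
  exact rellich_core hsm hφsm <| rI_zero hd hsm hper hφsm hφper hφharm hφdecay
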